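/- Let |ĩ⟩ : Fin K → (E × Ē → ℂ) be an orthonormal family spanning a code subspace. Suppose that for every matrix L : Matrix (Fin K) (Fin K) ℂ there exists an operator O_Ē on (Ē → ℂ) such that (I_E ⊗ O_Ē)|ĩ⟩ = Σ_j L_{ji}|j̃⟩ and (I_E ⊗ O_Ē)ᴴ|ĩ⟩ = Σ_j conj(L_{ij})|j̃⟩ for all i. Then for every linear operator X_E on (E → ℂ) there exists c ∈ ℂ with ⟨ĩ| (X_E ⊗ I_Ē) |j̃⟩ = δ_{ij} · c for all i, j; that is, the projection of every operator on E onto the code subspace is proportional to the identity. -/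

import Mathlib

open scoped ComplexConjugate Matrix Kronecker

/-- Inner product `⟨v,w⟩ = Σ conj(v)·w` on a finite-dimensional Hilbert space
modeled as functions to `ℂ`. -/
noncomputable def ip {ι : Type*} [Fintype ι] (v w : ι → ℂ) : ℂ :=
  ∑ x, conj (v x) * w x

/-- The action of an operator `X` on the `E` factor of the tensor product,
i.e. `X ⊗ I_Ebar`. -/
noncomputable def actE {E Ebar : Type*} [Fintype E] (X : Matrix E E ℂ)
    (v : E × Ebar → ℂ) : E × Ebar → ℂ :=
  fun p => ∑ m', X p.1 m' * v (m', p.2)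

/-- The action of an operator `Y` on the `Ebar` factor of the tensor product,
i.e. `I_E ⊗ Y`. -/
noncomputable def actEbar {E Ebar : Type*} [Fintype Ebar] (Y : Matrix Ebar Ebar ℂ)
    (v : E × Ebar → ℂ) : E × Ebar → ℂ :=
  fun p => ∑ a', Y p.2 a' * v (p.1, a')

lemma aux_adj {E Ebar : Type*} [Fintype E] [Fintype Ebar] (X : Matrix E E ℂ)
    (Y : Matrix Ebar Ebar ℂ) (v w : E × Ebar → ℂ) :
    ip v (actE X (actEbar Y w)) = ip (actEbar Yᴴ v) (actE X w) := by
  simp only [ip, actE, actEbar, Fintype.sum_prod_type, map_sum, map_mul,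
    Matrix.conjTranspose_apply, RCLike.star_def, Complex.conj_conj, Finset.mul_sum, Finset.sum_mul]
  refine Finset.sum_congr rfl fun m _ => ?_
  have h : ∀ a : Ebar, ∑ m' : E, ∑ a' : Ebar, conj (v (m, a)) * (X m m' * (Y a a' * w (m', a')))
      = ∑ a' : Ebar, ∑ m' : E, conj (v (m, a)) * (X m m' * (Y a a' * w (m', a'))) :=
    fun a => Finset.sum_comm
  simp only [h]
  rw [Finset.sum_comm]
  refine Finset.sum_congr rfl fun a' _ => ?_
  rw [Finset.sum_comm]
  refine Finset.sum_congr rfl fun m' _ => ?_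
  refine Finset.sum_congr rfl fun a _ => ?_
  ring

lemma aux_sc_left {ι : Type*} [Fintype ι] (c : ℂ) (v w : ι → ℂ) :
    ip (c • v) w = conj c * ip v w := by
  simp [ip, Finset.mul_sum, mul_assoc]

lemma aux_sc_right {E Ebar : Type*} [Fintype E] [Fintype Ebar] (X : Matrix E E ℂ)
    (c : ℂ) (v w : E × Ebar → ℂ) :
    ip v (actE X (c • w)) = c * ip v (actE X w) := by
  simp only [ip, actE, Finset.mul_sum, Pi.smul_apply, smul_eq_mul]
  refine Finset.sum_congr rfl fun p _ => Finset.sum_congr rfl fun m _ => ?_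
  ring

/-- If every logical matrix `L` on the code subspace can be realized by an
operator `O_Ebar` acting only on `Ebar` (together with its conjugate
transpose), then the projection of every operator `X_E` on `E` onto the code
subspace is proportional to the identity. -/
theorem realizability_implies_no_information
    {E Ebar : Type*} [Fintype E] [Fintype Ebar] [Nonempty E] [Nonempty Ebar] {K : ℕ}
    (ti : Fin K → (E × Ebar → ℂ))
    (horth : ∀ i j, ip (ti i) (ti j) = if i = j then 1 else 0)
    (hrec : ∀ L : Matrix (Fin K) (Fin K) ℂ, ∃ OEb : Matrix Ebar Ebar ℂ,
        (∀ i, actEbar OEb (ti i) = ∑ j, L j i • ti j) ∧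
        (∀ i, actEbar (OEbᴴ) (ti i) = ∑ j, conj (L i j) • ti j)) :
    ∀ X : Matrix E E ℂ, ∃ c : ℂ, ∀ i j,
      ip (ti i) (actE X (ti j)) = (if i = j then 1 else 0) * c := by
  intro X
  have key : ∀ i a b : Fin K, ip (ti i) (actE X (ti a)) =
      (if i = a then 1 else 0) * ip (ti b) (actE X (ti b)) := by
    intro i a b
    obtain ⟨Y, h1, h2⟩ := hrec (fun p q => if p = a ∧ q = b then 1 else 0)
    have e1 : actEbar Y (ti b) = (1 : ℂ) • ti a := by
      rw [h1 b, Finset.sum_eq_single a]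
      · simp
      · intro j _ hj
        simp [hj]
      · simp
    have e2 : actEbar Yᴴ (ti i) = (if i = a then (1 : ℂ) else 0) • ti b := by
      rw [h2 i, Finset.sum_eq_single b]
      · by_cases h : i = a <;> simp [h]
      · intro j _ hj
        simp [hj]
      · simp
    have h := aux_adj X Y (ti i) (ti b)
    rw [e1, e2, aux_sc_right, aux_sc_left, one_mul] at h
    rw [h]
    by_cases h : i = a <;> simp [h]
  rcases Nat.eq_zero_or_pos K with h0 | h0
  · subst h0
    exact ⟨0, fun i => i.elim0⟩
  · exact ⟨_, fun i j => key i j ⟨0, h0⟩⟩
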